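/- For every fixed positive integer K, the quantity m₁,N(𝕋_K²) converges to m₁(𝕋_K²) as N → ∞ (N ranging over positive integers). -/

import Mathlib

open MeasureTheory Filter
open scoped ENNReal

noncomputable section

/-- The Haar measure on the `K × K` torus `𝕋_K² = ℝ²/(Kℤ²)` (total mass `K²`). -/
def torusVolume (K : ℝ) : Measure (AddCircle K × AddCircle K) :=
  if hK : 0 < K then
    haveI : Fact (0 < K) := ⟨hK⟩
    (volume : Measure (AddCircle K × AddCircle K))
  else 0

/-- Normalized density of a subset of the torus `𝕋_K²`. -/
def density (K : ℝ) (A : Set (AddCircle K × AddCircle K)) : ℝ :=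
  (torusVolume K A).toReal / K ^ 2

/-- Autocorrelation function `f(x; A) = δ(A ∩ (A - x))`. -/
def autocorr (K : ℝ) (A : Set (AddCircle K × AddCircle K))
    (x : AddCircle K × AddCircle K) : ℝ :=
  density K (A ∩ (fun y => y + x) ⁻¹' A)

/-- Radialized pair correlation function `f°(r; A)`. -/
def paircorr (K : ℝ) (A : Set (AddCircle K × AddCircle K)) (r : ℝ) : ℝ :=
  (1 / (2 * Real.pi)) * ∫ θ in (0:ℝ)..(2 * Real.pi),
    autocorr K A (((r * Real.cos θ : ℝ) : AddCircle K), ((r * Real.sin θ : ℝ) : AddCircle K))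

/-- Normalized pair correlation `s(r; A) = f°(r; A) / δ(A)²`. -/
def scorr (K : ℝ) (A : Set (AddCircle K × AddCircle K)) (r : ℝ) : ℝ :=
  paircorr K A r / density K A ^ 2

/-- The closed grid square `[j/N,(j+1)/N] × [k/N,(k+1)/N]`, viewed inside the torus `𝕋_K²`. -/
def gridSquare (K N : ℕ) (v : Fin (N * K) × Fin (N * K)) :
    Set (AddCircle (K : ℝ) × AddCircle (K : ℝ)) :=
  {q | ∃ p : ℝ × ℝ, q = ((p.1 : AddCircle (K : ℝ)), (p.2 : AddCircle (K : ℝ))) ∧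
        (v.1 : ℝ) / N ≤ p.1 ∧ p.1 ≤ ((v.1 : ℝ) + 1) / N ∧
        (v.2 : ℝ) / N ≤ p.2 ∧ p.2 ≤ ((v.2 : ℝ) + 1) / N}

/-- A subset of `𝕋_K²` is locally constant at scale `1/N` if it is a union of grid squares. -/
def LocallyConst (K N : ℕ) (A : Set (AddCircle (K : ℝ) × AddCircle (K : ℝ))) : Prop :=
  ∃ S : Set (Fin (N * K) × Fin (N * K)), A = ⋃ v ∈ S, gridSquare K N v

/-- `m₁(𝕋_K²)`: the supremum of densities of measurable 1-avoiding subsets of the torus. -/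
def m1Torus (K : ℝ) : ℝ :=
  sSup {d : ℝ | ∃ A : Set (AddCircle K × AddCircle K),
    MeasurableSet A ∧ paircorr K A 1 = 0 ∧ d = density K A}

/-- `m₁,N(𝕋_K²)`: the supremum of densities of measurable 1-avoiding subsets of the torus
that are locally constant at scale `1/N`. -/
def m1TorusN (K N : ℕ) : ℝ :=
  sSup {d : ℝ | ∃ A : Set (AddCircle (K : ℝ) × AddCircle (K : ℝ)),
    MeasurableSet A ∧ LocallyConst K N A ∧ paircorr (K : ℝ) A 1 = 0 ∧ d = density (K : ℝ) A}

end

open scoped Topology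

/-- The point of the torus at distance `1` from the origin in the direction `θ`. -/
noncomputable def unitTranslation (T θ : ℝ) : AddCircle T × AddCircle T :=
  ((Real.cos θ : ℝ), (Real.sin θ : ℝ))

theorem continuous_unitTranslation {T : ℝ} : Continuous (unitTranslation T) :=
  ((AddCircle.continuous_mk' T).comp Real.continuous_cos).prodMk
    ((AddCircle.continuous_mk' T).comp Real.continuous_sin)

theorem paircorr_one {T : ℝ} (A : Set (AddCircle T × AddCircle T)) :
    paircorr T A 1 =
      1 / (2 * Real.pi) * ∫ θ in (0 : ℝ)..(2 * Real.pi), autocorr T A (unitTranslation T θ) := by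
  simp only [paircorr, one_mul, unitTranslation]

/-- On a compact set without unit distances, the unit distances are avoided uniformly. -/
theorem IsCompact.exists_pos_lt_norm_sub_unitTranslation {T : ℝ}
    {C : Set (AddCircle T × AddCircle T)}
    (hC : IsCompact C)
    (h : ∀ x ∈ C, ∀ y ∈ C, ∀ θ ∈ Set.Icc 0 (2 * Real.pi), y - x - unitTranslation T θ ≠ 0) :
    ∃ η > 0, ∀ x ∈ C, ∀ y ∈ C, ∀ θ ∈ Set.Icc 0 (2 * Real.pi),
      η < ‖y - x - unitTranslation T θ‖ := by
  have hcont : Continuous fun p : ((AddCircle T × AddCircle T) × (AddCircle T × AddCircle T)) × ℝ =>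
      ‖p.1.2 - p.1.1 - unitTranslation T p.2‖ :=
    ((continuous_fst.snd.sub continuous_fst.fst).sub
      (continuous_unitTranslation.comp continuous_snd)).norm
  obtain ⟨η, hη, hlt⟩ := ((hC.prod hC).prod isCompact_Icc).exists_forall_le' hcont.continuousOn
    (a := 0) (fun p hp => norm_pos_iff.2 (h _ hp.1.1 _ hp.1.2 _ hp.2))
  exact ⟨η / 2, half_pos hη, fun x hx y hy θ hθ =>
    (half_lt_self hη).trans_le (hlt ((x, y), θ) ⟨⟨hx, hy⟩, hθ⟩)⟩

section Torus

variable {T : ℝ} [hT : Fact (0 < T)]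

instance isAddHaarMeasure_torus :
    (volume : Measure (AddCircle T × AddCircle T)).IsAddHaarMeasure :=
  inferInstanceAs
    ((volume : Measure (AddCircle T)).prod (volume : Measure (AddCircle T))).IsAddHaarMeasure

theorem torusVolume_eq : torusVolume T = volume := dif_pos hT.out

theorem density_eq (A : Set (AddCircle T × AddCircle T)) :
    density T A = volume.real A / T ^ 2 := by
  rw [density, torusVolume_eq, Measure.real]

theorem density_mono {A B : Set (AddCircle T × AddCircle T)} (h : A ⊆ B) :
    density T A ≤ density T B := by
  rw [density_eq, density_eq]
  exact div_le_div_of_nonneg_right (measureReal_mono h) (sq_nonneg T)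

theorem density_nonneg (A : Set (AddCircle T × AddCircle T)) : 0 ≤ density T A := by
  rw [density_eq]; positivity

theorem density_le_one (A : Set (AddCircle T × AddCircle T)) : density T A ≤ 1 := by
  have h : (volume : Measure (AddCircle T × AddCircle T)).real Set.univ = T ^ 2 := by
    rw [Measure.volume_eq_prod, ← Set.univ_prod_univ, measureReal_prod_prod]
    simp [Measure.real, hT.out.le, sq]
  calc density T A ≤ density T Set.univ := density_mono A.subset_univ
    _ = 1 := by rw [density_eq, h]; exact div_self (pow_ne_zero _ hT.out.ne')

theorem continuous_autocorr {A : Set (AddCircle T × AddCircle T)} (hA : MeasurableSet A) :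
    Continuous (autocorr T A) := by
  let τ : C(AddCircle T × AddCircle T, C(AddCircle T × AddCircle T, AddCircle T × AddCircle T)) :=
    ContinuousMap.curry ⟨fun p => p.2 + p.1, by fun_prop⟩
  have hτ : ∀ x, MeasurePreserving (τ x) volume volume :=
    fun x => measurePreserving_add_right volume x
  have key : Continuous fun x => volume.real (A ∩ τ x ⁻¹' A) := by
    refine continuous_iff_continuousAt.2 fun x => ?_
    have h0 := tendsto_measure_symmDiff_preimage_nhds_zero (τ.continuous.tendsto x)
      (.of_forall hτ) (hτ x) hA.nullMeasurableSet (measure_ne_top _ _)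
    have h1 := (ENNReal.tendsto_toReal ENNReal.zero_ne_top).comp h0
    refine tendsto_iff_dist_tendsto_zero.2 (squeeze_zero (fun _ => dist_nonneg) (fun y => ?_) h1)
    have hm : ∀ z, MeasurableSet (τ z ⁻¹' A) := fun z => (hτ z).measurable hA
    refine (abs_measureReal_sub_le_measureReal_symmDiff (hA.inter (hm y)).nullMeasurableSet
      (hA.inter (hm x)).nullMeasurableSet).trans ?_
    rw [← Set.inter_symmDiff_distrib_left]
    exact measureReal_mono Set.inter_subset_right
  have heq : autocorr T A = fun x => volume.real (A ∩ τ x ⁻¹' A) / T ^ 2 :=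
    funext fun x => density_eq _
  rw [heq]
  exact key.div_const _

/-- A `1`-avoiding set meets each of its unit translates in a null set. -/
theorem autocorr_eq_zero_of_paircorr_eq_zero {A : Set (AddCircle T × AddCircle T)}
    (hA : MeasurableSet A) (h : paircorr T A 1 = 0) {θ : ℝ} (hθ : θ ∈ Set.Icc 0 (2 * Real.pi)) :
    autocorr T A (unitTranslation T θ) = 0 := by
  rw [paircorr_one] at h
  have hint := (mul_eq_zero.1 h).resolve_left (by positivity)
  by_contra hne
  refine hint.not_gt (intervalIntegral.integral_pos Real.two_pi_pos ?_ ?_ ?_)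
  · exact ((continuous_autocorr hA).comp continuous_unitTranslation).continuousOn
  · exact fun _ _ => density_nonneg _
  · exact ⟨θ, hθ, (density_nonneg _).lt_of_ne (Ne.symm hne)⟩

instance isUnifLocDoublingMeasure_torus :
    IsUnifLocDoublingMeasure (volume : Measure (AddCircle T × AddCircle T)) := by
  refine ⟨⟨4, Eventually.of_forall fun ε x => ?_⟩⟩
  have h : ∀ y : AddCircle T, volume (Metric.closedBall y (2 * ε)) ≤
      2 * volume (Metric.closedBall y ε) := fun y => by
    rw [AddCircle.volume_closedBall, AddCircle.volume_closedBall, ← ENNReal.ofReal_ofNat,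
      ← ENNReal.ofReal_mul zero_le_two]
    apply ENNReal.ofReal_le_ofReal
    rw [mul_min_of_nonneg _ _ zero_le_two]
    exact min_le_min (by linarith [hT.out]) le_rfl
  rw [← closedBall_prod_same, ← closedBall_prod_same, Measure.volume_eq_prod,
    Measure.prod_prod, Measure.prod_prod]
  calc _ ≤ (2 * volume (Metric.closedBall x.1 ε)) * (2 * volume (Metric.closedBall x.2 ε)) :=
        mul_le_mul' (h _) (h _)
    _ = _ := by push_cast; ring

/-- If `A` meets its translate by `-u` in a null set, no two points at which `A` has
density greater than one half differ by `u`. -/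
theorem not_majority_of_null_inter {A : Set (AddCircle T × AddCircle T)}
    (hA : MeasurableSet A) {u x : AddCircle T × AddCircle T}
    (hu : volume (A ∩ (fun y => y + u) ⁻¹' A) = 0) {δ : ℝ}
    (hx : volume (Metric.closedBall x δ) / 2 < volume (A ∩ Metric.closedBall x δ))
    (hxu : volume (Metric.closedBall (x + u) δ) / 2 < volume (A ∩ Metric.closedBall (x + u) δ)) :
    False := by
  have hpre : (fun y => y + u) ⁻¹' Metric.closedBall (x + u) δ = Metric.closedBall x δ := by
    ext y; simp
  have hball : volume (Metric.closedBall (x + u) δ) = volume (Metric.closedBall x δ) := by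
    rw [← hpre, measure_preimage_add_right]
  have hinter : volume (A ∩ Metric.closedBall (x + u) δ) =
      volume ((fun y => y + u) ⁻¹' A ∩ Metric.closedBall x δ) := by
    rw [← measure_preimage_add_right volume u, Set.preimage_inter, hpre]
  rw [hball, hinter] at hxu
  have hdisj : AEDisjoint volume (A ∩ Metric.closedBall x δ)
      ((fun y => y + u) ⁻¹' A ∩ Metric.closedBall x δ) :=
    measure_mono_null
      (Set.inter_subset_inter Set.inter_subset_left Set.inter_subset_left) hu
  have hm : MeasurableSet ((fun y => y + u) ⁻¹' A ∩ Metric.closedBall x δ) :=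
    (measurable_add_const u hA).inter Metric.isClosed_closedBall.measurableSet
  have hsum := measure_union₀ hm.nullMeasurableSet hdisj
  have hle : volume ((A ∩ Metric.closedBall x δ) ∪
      ((fun y => y + u) ⁻¹' A ∩ Metric.closedBall x δ)) ≤ volume (Metric.closedBall x δ) :=
    measure_mono (Set.union_subset Set.inter_subset_right Set.inter_subset_right)
  have hlt := ENNReal.add_lt_add hx hxu
  rw [ENNReal.add_halves, ← hsum] at hlt
  exact hlt.not_ge hle

/-- At almost every point of `A`, the set `A` occupies most of every small ball. -/
theorem ae_eventually_majority (A : Set (AddCircle T × AddCircle T)) :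
    ∀ᵐ x ∂volume.restrict A, ∀ᶠ δ in 𝓝[>] (0 : ℝ),
      volume (Metric.closedBall x δ) / 2 < volume (A ∩ Metric.closedBall x δ) := by
  filter_upwards [IsUnifLocDoublingMeasure.ae_tendsto_measure_inter_div volume A 1] with x hx
  have hlim := hx (fun _ : ℝ => x) id (l := 𝓝[>] (0 : ℝ)) tendsto_id (by
    filter_upwards [self_mem_nhdsWithin] with δ hδ
    simpa using (le_of_lt hδ : (0 : ℝ) ≤ δ))
  filter_upwards [hlim.eventually
      (lt_mem_nhds (ENNReal.half_lt_self one_ne_zero ENNReal.one_ne_top)),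
    self_mem_nhdsWithin] with δ hδ hpos
  have hne : volume (Metric.closedBall x δ) ≠ 0 :=
    (Metric.measure_closedBall_pos volume x hpos).ne'
  rw [id, ENNReal.lt_div_iff_mul_lt (.inl hne) (.inl (measure_ne_top _ _))] at hδ
  rwa [one_div, mul_comm, ← div_eq_mul_inv] at hδ

/-- A `1`-avoiding set contains compact sets of almost full measure
without any pair of points at distance one. -/
theorem exists_isCompact_forall_ne_add_unitTranslation {A : Set (AddCircle T × AddCircle T)}
    (hA : MeasurableSet A) (h : paircorr T A 1 = 0) {ε : ℝ} (hε : 0 < ε) :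
    ∃ C : Set (AddCircle T × AddCircle T), IsCompact C ∧ density T A ≤ density T C + ε ∧
      ∀ x ∈ C, ∀ y ∈ C, ∀ θ ∈ Set.Icc 0 (2 * Real.pi), y - x - unitTranslation T θ ≠ 0 := by
  have hT0 : 0 < T := hT.out
  obtain ⟨G, hG, hGm, hG0⟩ :=
    ((ae_restrict_iff' hA).1 (ae_eventually_majority A)).exists_measurable_mem
  have hAG : volume (A ∩ G) = volume A :=
    measure_inter_conull (by simpa [mem_ae_iff] using hG)
  have hε' : ENNReal.ofReal (ε * T ^ 2) ≠ 0 := by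
    simpa using by positivity
  obtain ⟨C, hCA, hC, hlt⟩ :=
    (hA.inter hGm).exists_isCompact_lt_add (measure_ne_top volume _) hε'
  refine ⟨C, hC, ?_, ?_⟩
  · rw [hAG] at hlt
    have := ENNReal.toReal_mono (by finiteness) hlt.le
    rw [ENNReal.toReal_add (by finiteness) (by finiteness),
      ENNReal.toReal_ofReal (by positivity)] at this
    rw [density_eq, density_eq, div_add' _ _ _ (by positivity)]
    gcongr
    exact this
  · intro x hx y hy θ hθ hxy
    have hau := autocorr_eq_zero_of_paircorr_eq_zero hA h hθ
    rw [autocorr, density_eq, div_eq_zero_iff, or_iff_left (by positivity),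
      measureReal_eq_zero_iff] at hau
    have hy' : y = x + unitTranslation T θ := by
      rw [sub_sub, sub_eq_zero] at hxy; exact hxy
    obtain ⟨δ, h1, h2⟩ := ((hG0 x (hCA hx).2 (hCA hx).1).and (hG0 y (hCA hy).2 (hCA hy).1)).exists
    rw [hy'] at h2
    exact not_majority_of_null_inter hA hau h1 h2

theorem paircorr_eq_zero_of_forall_ne {A : Set (AddCircle T × AddCircle T)}
    (h : ∀ x ∈ A, ∀ y ∈ A, ∀ θ ∈ Set.Icc 0 (2 * Real.pi), y - x - unitTranslation T θ ≠ 0) :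
    paircorr T A 1 = 0 := by
  rw [paircorr_one, intervalIntegral.integral_congr (g := fun _ => (0 : ℝ))]
  · simp
  · intro θ hθ
    rw [Set.uIcc_of_le Real.two_pi_pos.le] at hθ
    have hempty : A ∩ (fun y => y + unitTranslation T θ) ⁻¹' A = ∅ :=
      Set.eq_empty_of_forall_notMem fun x hx => h x hx.1 _ hx.2 θ hθ (by simp)
    simp [autocorr, hempty, density_eq]

end Torus

section Grid

variable {K N : ℕ}

theorem gridSquare_eq_image (v : Fin (N * K) × Fin (N * K)) :
    gridSquare K N v = (fun p : ℝ × ℝ => ((p.1 : AddCircle (K : ℝ)), (p.2 : AddCircle (K : ℝ)))) ''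
      (Set.Icc ((v.1 : ℝ) / N) (((v.1 : ℝ) + 1) / N) ×ˢ
        Set.Icc ((v.2 : ℝ) / N) (((v.2 : ℝ) + 1) / N)) := by
  ext q
  constructor
  · rintro ⟨p, hq, h1, h2, h3, h4⟩
    exact ⟨p, ⟨⟨h1, h2⟩, ⟨h3, h4⟩⟩, hq.symm⟩
  · rintro ⟨p, ⟨⟨h1, h2⟩, ⟨h3, h4⟩⟩, hq⟩
    exact ⟨p, hq.symm, h1, h2, h3, h4⟩

theorem isCompact_gridSquare (v : Fin (N * K) × Fin (N * K)) : IsCompact (gridSquare K N v) := by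
  rw [gridSquare_eq_image]
  exact (isCompact_Icc.prod isCompact_Icc).image
    (((AddCircle.continuous_mk' _).comp continuous_fst).prodMk
      ((AddCircle.continuous_mk' _).comp continuous_snd))

theorem LocallyConst.measurableSet {A : Set (AddCircle (K : ℝ) × AddCircle (K : ℝ))}
    (hA : LocallyConst K N A) : MeasurableSet A := by
  obtain ⟨S, rfl⟩ := hA
  exact (S.toFinite.isCompact_biUnion fun v _ => isCompact_gridSquare v).isClosed.measurableSet

theorem norm_sub_le_of_mem_gridSquare {v : Fin (N * K) × Fin (N * K)}
    {x y : AddCircle (K : ℝ) × AddCircle (K : ℝ)}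
    (hx : x ∈ gridSquare K N v) (hy : y ∈ gridSquare K N v) : ‖x - y‖ ≤ 1 / N := by
  have key : ∀ (k : ℕ) {a b : ℝ}, (k : ℝ) / N ≤ a → a ≤ ((k : ℝ) + 1) / N → (k : ℝ) / N ≤ b →
      b ≤ ((k : ℝ) + 1) / N → ‖(a : AddCircle (K : ℝ)) - (b : AddCircle (K : ℝ))‖ ≤ 1 / N := by
    intro k a b ha ha' hb hb'
    rw [add_div] at ha' hb'
    rw [← AddCircle.coe_sub]
    refine (QuotientAddGroup.norm_mk_le_norm).trans ?_
    rw [Real.norm_eq_abs, abs_sub_le_iff]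
    constructor <;> linarith
  obtain ⟨p, rfl, h1, h2, h3, h4⟩ := hx
  obtain ⟨q, rfl, h1', h2', h3', h4'⟩ := hy
  exact max_le (key _ h1 h2 h1' h2') (key _ h3 h4 h3' h4')

theorem exists_fin_mem_Icc_div (hK : 0 < K) (hN : 0 < N) (a : AddCircle (K : ℝ)) :
    ∃ (j : Fin (N * K)) (t : ℝ), a = t ∧ (j : ℝ) / N ≤ t ∧ t ≤ ((j : ℝ) + 1) / N := by
  have : Fact (0 < (K : ℝ)) := ⟨by exact_mod_cast hK⟩
  have hN' : (0 : ℝ) < N := by exact_mod_cast hN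
  obtain ⟨t, ⟨ht0, htK⟩, rfl⟩ :
      a ∈ (fun t : ℝ => (t : AddCircle (K : ℝ))) '' Set.Ico 0 (0 + K) := by
    rw [AddCircle.coe_image_Ico_eq]; trivial
  rw [zero_add] at htK
  refine ⟨⟨⌊t * N⌋₊, ?_⟩, t, rfl, ?_, ?_⟩
  · rw [Nat.floor_lt (by positivity)]
    push_cast
    nlinarith
  · rw [div_le_iff₀ hN']
    exact Nat.floor_le (by positivity)
  · rw [le_div_iff₀ hN']
    exact (Nat.lt_floor_add_one _).le

theorem exists_mem_gridSquare (hK : 0 < K) (hN : 0 < N)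
    (x : AddCircle (K : ℝ) × AddCircle (K : ℝ)) :
    ∃ v : Fin (N * K) × Fin (N * K), x ∈ gridSquare K N v := by
  obtain ⟨j, s, hs, h1, h2⟩ := exists_fin_mem_Icc_div hK hN x.1
  obtain ⟨k, t, ht, h3, h4⟩ := exists_fin_mem_Icc_div hK hN x.2
  exact ⟨(j, k), (s, t), Prod.ext hs ht, h1, h2, h3, h4⟩

/-- For large `N`, a set whose unit distances are uniformly avoided is contained in
a `1`-avoiding union of grid squares. -/
theorem exists_locallyConst_superset (hK : 0 < K) (hN : 0 < N)
    {C : Set (AddCircle (K : ℝ) × AddCircle (K : ℝ))} {η : ℝ} (hη : 2 / N ≤ η)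
    (h : ∀ x ∈ C, ∀ y ∈ C, ∀ θ ∈ Set.Icc 0 (2 * Real.pi),
      η < ‖y - x - unitTranslation (K : ℝ) θ‖) :
    ∃ A, LocallyConst K N A ∧ C ⊆ A ∧ paircorr (K : ℝ) A 1 = 0 := by
  have : Fact (0 < (K : ℝ)) := ⟨by exact_mod_cast hK⟩
  refine ⟨⋃ v ∈ {v | (gridSquare K N v ∩ C).Nonempty}, gridSquare K N v, ⟨_, rfl⟩, ?_, ?_⟩
  · intro x hx
    obtain ⟨v, hv⟩ := exists_mem_gridSquare hK hN x
    exact Set.mem_biUnion (show v ∈ {v | _} from ⟨x, hv, hx⟩) hv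
  · refine paircorr_eq_zero_of_forall_ne fun x hx y hy θ hθ hxy => ?_
    obtain ⟨v, ⟨x', hx', hxC⟩, hxv⟩ := Set.mem_iUnion₂.1 hx
    obtain ⟨w, ⟨y', hy', hyC⟩, hyw⟩ := Set.mem_iUnion₂.1 hy
    have heq : y' - x' - unitTranslation (K : ℝ) θ = (y' - y) + (x - x') := by
      rw [sub_sub, sub_eq_zero] at hxy
      rw [hxy]; abel
    have hle := norm_add_le_of_le (norm_sub_le_of_mem_gridSquare hy' hyw)
      (norm_sub_le_of_mem_gridSquare hxv hx')
    rw [← heq, ← add_div, one_add_one_eq_two] at hle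
    exact ((h x' hxC y' hyC θ hθ).trans_le hle).not_ge hη

end Grid

/-- For every fixed positive integer `K`, `m₁,N(𝕋_K²) → m₁(𝕋_K²)` as `N → ∞`. -/
theorem m1TorusN_tendsto_m1Torus (K : ℕ) (hK : 0 < K) :
    Tendsto (fun N : ℕ => m1TorusN K N) atTop (nhds (m1Torus (K : ℝ))) := by
  have : Fact (0 < (K : ℝ)) := ⟨by exact_mod_cast hK⟩
  have hempty : paircorr (K : ℝ) ∅ 1 = 0 := paircorr_eq_zero_of_forall_ne (by simp)
  have hle : ∀ N, m1TorusN K N ≤ m1Torus (K : ℝ) := fun N => by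
    refine csSup_le_csSup ⟨1, ?_⟩ ⟨_, ∅, .empty, ⟨∅, by simp⟩, hempty, rfl⟩ ?_
    · rintro _ ⟨A, -, -, rfl⟩
      exact density_le_one A
    · rintro _ ⟨A, hA, -, h, rfl⟩
      exact ⟨A, hA, h, rfl⟩
  refine tendsto_order.2 ⟨fun a ha => ?_, fun b hb => .of_forall fun N => (hle N).trans_lt hb⟩
  obtain ⟨_, ⟨A, hA, hA1, rfl⟩, hlt⟩ := exists_lt_of_lt_csSup
    (by exact ⟨_, ∅, .empty, hempty, rfl⟩) ha
  obtain ⟨C, hC, hdens, hC1⟩ := exists_isCompact_forall_ne_add_unitTranslation hA hA1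
    (half_pos (sub_pos.2 hlt))
  obtain ⟨η, hη, hCη⟩ := hC.exists_pos_lt_norm_sub_unitTranslation hC1
  filter_upwards [(tendsto_const_div_atTop_nhds_zero_nat 2).eventually (ge_mem_nhds hη),
    eventually_gt_atTop 0] with N hN hN0
  obtain ⟨B, hB, hCB, hB1⟩ := exists_locallyConst_superset hK hN0 hN hCη
  have hBle : density (K : ℝ) B ≤ m1TorusN K N := by
    refine le_csSup ⟨1, ?_⟩ ⟨B, hB.measurableSet, hB, hB1, rfl⟩
    rintro _ ⟨A, -, -, -, rfl⟩
    exact density_le_one A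
  linarith [density_mono hCB]
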